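/- Let n > 1. The number of symmetric subsets S ⊆ ℤ/nℤ with 0 ∉ S for which the circulant graph D(ℤ/nℤ, S) is integral is at most 2^{d(n) - 1}, where d(n) is the number of positive divisors of n. -/

import Mathlib

/-- A `ℚ`-polynomial vanishing at one primitive `n`-th root of unity vanishes at all of them. -/
lemma IsPrimitiveRoot.aeval_eq_zero_of_aeval_eq_zero {n : ℕ} (hn : 0 < n) {ζ ξ : ℂ}
    (hζ : IsPrimitiveRoot ζ n) (hξ : IsPrimitiveRoot ξ n) (p : Polynomial ℚ)
    (hp : Polynomial.aeval ζ p = 0) : Polynomial.aeval ξ p = 0 := by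
  rw [← minpoly.dvd_iff, ← Polynomial.cyclotomic_eq_minpoly_rat hξ hn,
    Polynomial.cyclotomic_eq_minpoly_rat hζ hn, minpoly.dvd_iff]
  exact hp

lemma ZMod.isPrimitiveRoot_stdAddChar_one (n : ℕ) [NeZero n] :
    IsPrimitiveRoot (ZMod.stdAddChar (1 : ZMod n)) n := by
  have h := ZMod.stdAddChar_coe (N := n) 1
  simp only [Int.cast_one, mul_one] at h
  rw [h]
  exact Complex.isPrimitiveRoot_exp n (NeZero.ne n)

lemma ZMod.isPrimitiveRoot_stdAddChar_unit {n : ℕ} [NeZero n] (u : (ZMod n)ˣ) :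
    IsPrimitiveRoot (ZMod.stdAddChar (u : ZMod n)) n := by
  have h : ZMod.stdAddChar (u : ZMod n) =
      ZMod.stdAddChar (1 : ZMod n) ^ (u : ZMod n).val := by
    rw [← AddChar.map_nsmul_eq_pow]
    simp
  rw [h]
  exact (ZMod.isPrimitiveRoot_stdAddChar_one n).pow_of_coprime _ (ZMod.val_coe_unit_coprime u)

/-- A character sum over `S` is an eigenvalue of the circulant matrix with connection set `S`. -/
lemma ZMod.sum_stdAddChar_mem_spectrum {n : ℕ} [NeZero n] (S : Finset (ZMod n)) (k : ZMod n) :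
    ∑ s ∈ S, ZMod.stdAddChar (k * s) ∈ spectrum ℂ
      (Matrix.of fun g h : ZMod n => if h - g ∈ S then (1 : ℂ) else 0) := by
  rw [← Matrix.spectrum_toLin']
  refine Module.End.HasEigenvalue.mem_spectrum
    (Module.End.hasEigenvalue_of_hasEigenvector
      (x := fun h : ZMod n => ZMod.stdAddChar (k * h)) ⟨?_, ?_⟩)
  · rw [Module.End.mem_eigenspace_iff]
    ext g
    simp only [Matrix.toLin'_apply, Matrix.mulVec, dotProduct, Matrix.of_apply, Pi.smul_apply,
      smul_eq_mul, ite_mul, one_mul, zero_mul]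
    rw [← Equiv.sum_comp (Equiv.addRight g)]
    simp [mul_add, AddChar.map_add_eq_mul, Finset.sum_mul, Finset.sum_ite_mem]
  · intro h
    simpa using congrFun h 0

/-- If all character sums over `S` are integers, they are invariant under twisting by units. -/
lemma ZMod.sum_stdAddChar_unit_mul {n : ℕ} [NeZero n] (S : Finset (ZMod n)) (k : ZMod n)
    (u : (ZMod n)ˣ) (h : ∃ m : ℤ, ∑ s ∈ S, ZMod.stdAddChar (k * s) = (m : ℂ)) :
    ∑ s ∈ S, ZMod.stdAddChar (k * s * (u : ZMod n)) = ∑ s ∈ S, ZMod.stdAddChar (k * s) := by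
  obtain ⟨m, hm⟩ := h
  have eval_eq (v : ZMod n) : Polynomial.aeval (ZMod.stdAddChar v)
      (∑ s ∈ S, (Polynomial.X : Polynomial ℚ) ^ (k * s).val - (m : Polynomial ℚ)) =
      ∑ s ∈ S, ZMod.stdAddChar (k * s * v) - (m : ℂ) := by
    simp [← AddChar.map_nsmul_eq_pow]
  have hu := IsPrimitiveRoot.aeval_eq_zero_of_aeval_eq_zero (NeZero.pos n)
    (ZMod.isPrimitiveRoot_stdAddChar_one n) (ZMod.isPrimitiveRoot_stdAddChar_unit u)
    (∑ s ∈ S, Polynomial.X ^ (k * s).val - (m : Polynomial ℚ))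
    (by rw [eval_eq]; simp [hm])
  rw [eval_eq] at hu
  rw [hm, sub_eq_zero.mp hu]

/-- If all character sums over `S` are integers, then `S` is stable under the unit group. -/
lemma ZMod.unit_mul_mem_iff {n : ℕ} [NeZero n] (S : Finset (ZMod n))
    (h : ∀ k : ZMod n, ∃ m : ℤ, ∑ s ∈ S, ZMod.stdAddChar (k * s) = (m : ℂ))
    (u : (ZMod n)ˣ) (x : ZMod n) : (u : ZMod n) * x ∈ S ↔ x ∈ S := by
  have key : ZMod.dft (fun x : ZMod n => if (u : ZMod n) * x ∈ S then (1 : ℂ) else 0) =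
      ZMod.dft (fun x : ZMod n => if x ∈ S then (1 : ℂ) else 0) := by
    ext k
    have hk := ZMod.sum_stdAddChar_unit_mul S (-k) u⁻¹ (h (-k))
    simp only [ZMod.dft_apply, smul_eq_mul, mul_ite, mul_one, mul_zero]
    rw [← Equiv.sum_comp (Units.mulLeft u⁻¹) fun x : ZMod n =>
      if (u : ZMod n) * x ∈ S then ZMod.stdAddChar (-(x * k)) else 0]
    simp only [Units.mulLeft_apply, Units.mul_inv_cancel_left, Finset.sum_ite_mem,
      Finset.univ_inter]
    convert hk using 4 <;> ring
  have hx := congrFun (ZMod.dft.injective key) x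
  by_cases h₁ : (u : ZMod n) * x ∈ S <;> by_cases h₂ : x ∈ S <;> simp_all

/-- For `n > 1`, the number of symmetric subsets `S ⊆ ℤ/nℤ` with `0 ∉ S` whose
circulant graph `D(ℤ/nℤ, S)` is integral is at most `2 ^ (d(n) - 1)`, where `d(n)` is
the number of positive divisors of `n`. -/
theorem card_integral_circulant_le_two_pow
    (n : ℕ) [NeZero n] (hn : 1 < n) :
    Set.ncard {S : Finset (ZMod n) | (∀ s ∈ S, -s ∈ S) ∧ (0 : ZMod n) ∉ S ∧
        ∀ μ ∈ spectrum ℂ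
          (Matrix.of fun g h : ZMod n => if h - g ∈ S then (1 : ℂ) else 0),
          ∃ m : ℤ, μ = (m : ℂ)} ≤
      2 ^ (n.divisors.card - 1) := by
  classical
  have hcard : n.divisors.card - 1 = n.properDivisors.card := by
    rw [← Nat.insert_self_properDivisors (by lia),
      Finset.card_insert_of_notMem Nat.self_notMem_properDivisors, Nat.add_sub_cancel]
  rw [hcard, ← Finset.card_powerset, ← Set.ncard_coe_finset]
  refine Set.ncard_le_ncard_of_injOn
    (fun S : Finset (ZMod n) => n.properDivisors.filter fun d => (d : ZMod n) ∈ S)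
    (fun S _ => Finset.mem_coe.mpr <|
      Finset.mem_powerset.mpr (Finset.filter_subset _ _)) ?_ (Finset.finite_toSet _)
  rintro S ⟨-, hS₀, hS⟩ T ⟨-, hT₀, hT⟩ hST
  ext x
  obtain ⟨d, hd, u, hu, rfl⟩ := ZMod.eq_unit_mul_divisor x
  lift u to (ZMod n)ˣ using hu
  rw [ZMod.unit_mul_mem_iff S (fun k => hS _ (ZMod.sum_stdAddChar_mem_spectrum S k)),
    ZMod.unit_mul_mem_iff T (fun k => hT _ (ZMod.sum_stdAddChar_mem_spectrum T k))]
  obtain rfl | hdn := eq_or_ne d n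
  · simp [hS₀, hT₀]
  · have hmem : d ∈ n.properDivisors :=
      Nat.mem_properDivisors.mpr ⟨hd, (Nat.le_of_dvd (by lia) hd).lt_of_ne hdn⟩
    simpa [hmem] using Finset.ext_iff.mp hST d
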